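/- arXiv:1206.3977 — 3 statements merged into one kernel-verified Lean document; each statement's English description precedes it below -/
import Mathlib

section
/- With the same notation, if depth_S(I/J) > d+i then r = rank(h_{n-d-i+1}) + rank(h_{n-d-i}), where r = ρ_{d+i}(I\J). -/
open MvPolynomial

/-- A squarefree exponent vector. -/
def IsSqfree {n : ℕ} (m : Fin n →₀ ℕ) : Prop := ∀ j, m j ≤ 1

/-- Total degree of an exponent vector. -/
def mdeg {n : ℕ} (m : Fin n →₀ ℕ) : ℕ := m.sum fun _ e => e

/-- `I` is generated by squarefree monomials of degree `≥ d`. -/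
def GenSqfreeGe (K : Type*) [Field K] {n : ℕ} (d : ℕ)
    (I : Ideal (MvPolynomial (Fin n) K)) : Prop :=
  ∃ G : Set (Fin n →₀ ℕ), (∀ m ∈ G, IsSqfree m ∧ d ≤ mdeg m) ∧
    I = Ideal.span ((fun m => monomial m (1 : K)) '' G)

/-- `ρ_t(I \ J)`: the number of squarefree monomials of degree `t` in `I \ J`. -/
noncomputable def rho (K : Type*) [Field K] {n : ℕ}
    (I J : Ideal (MvPolynomial (Fin n) K)) (t : ℕ) : ℕ :=
  Set.ncard {m : Fin n →₀ ℕ | IsSqfree m ∧ mdeg m = t ∧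
    monomial m (1 : K) ∈ I ∧ monomial m (1 : K) ∉ J}

/-- The `S`-module `I/J`. -/
abbrev quotMod {K : Type*} [Field K] {n : ℕ}
    (I J : Ideal (MvPolynomial (Fin n) K)) :=
  I ⧸ (Submodule.comap I.subtype (J : Submodule (MvPolynomial (Fin n) K) (MvPolynomial (Fin n) K)))

/-- Depth of a module over `K[x_1,…,x_n]` w.r.t. the maximal graded ideal
`(x_1,…,x_n)`: the supremum of lengths of regular sequences on `M` from it. -/
noncomputable def mdepth (K : Type*) [Field K] (n : ℕ)
    (M : Type*) [AddCommGroup M] [Module (MvPolynomial (Fin n) K) M] : ℕ :=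
  sSup {k | ∃ rs : List (MvPolynomial (Fin n) K), rs.length = k ∧
    (∀ r ∈ rs, r ∈ Ideal.span (Set.range (X : Fin n → MvPolynomial (Fin n) K))) ∧
    RingTheory.Sequence.IsRegular M rs}

open Classical in
/-- The Koszul sign: if `b = f · x_j` this is the sign with which `x_j e_{σ_f}`
appears in `∂(e_{τ_b})`, where `e_σ` for a squarefree monomial is the wedge of the
`e_l` over `l` outside its support; otherwise `0`. -/
noncomputable def kSign (K : Type*) [Field K] {n : ℕ} (f b : Fin n →₀ ℕ) : K :=
  if h : ∃ j, b = f + Finsupp.single j 1 then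
    (-1 : K) ^ (Finset.univ.filter (fun l : Fin n => f l = 0 ∧ l < h.choose)).card
  else 0

section Koszul

variable {R M : Type*} [CommRing R] [AddCommGroup M] [Module R M] {n : ℕ}

/-- The sign attached to adjoining or deleting `j` from `τ`: the parity of the number of
indices below `j` outside `τ`. -/
def koszulSign (R : Type*) [CommRing R] {n : ℕ} (j : Fin n) (τ : Finset (Fin n)) : R :=
  (-1) ^ (Finset.univ.filter fun l : Fin n => l ∉ τ ∧ l < j).card

/-- The Koszul differential of the sequence `x` with coefficients in `M`; the summand
`e_σ` of the Koszul complex is indexed by the complement of `σ`. -/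
def koszulD (x : Fin n → R) (φ : Finset (Fin n) → M) (τ : Finset (Fin n)) : M :=
  ∑ j, if j ∈ τ then (koszulSign R j τ * x j) • φ (τ.erase j) else 0

/-- Exterior multiplication by `∑ a_j e_j`, the contracting homotopy for `∑ a_j x_j`. -/
def koszulHomotopy (a : Fin n → R) (φ : Finset (Fin n) → M) (τ : Finset (Fin n)) : M :=
  ∑ j, if j ∈ τ then 0 else (koszulSign R j τ * a j) • φ (insert j τ)

lemma koszulSign_mul_self (j : Fin n) (τ : Finset (Fin n)) :
    koszulSign R j τ * koszulSign R j τ = 1 := by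
  rw [koszulSign, ← pow_add, Even.neg_one_pow ⟨_, rfl⟩]

lemma koszulSign_insert {i j : Fin n} {τ : Finset (Fin n)} (hi : i ∉ τ) :
    koszulSign R j τ = koszulSign R j (insert i τ) * if i < j then -1 else 1 := by
  unfold koszulSign
  split_ifs with h
  · rw [← pow_succ]
    congr 1
    rw [← Finset.card_insert_of_notMem (a := i) (by simp)]
    congr 1
    ext l
    simp only [Finset.mem_filter, Finset.mem_univ, true_and, Finset.mem_insert]
    grind
  · rw [mul_one]
    congr 2
    ext l
    simp only [Finset.mem_filter, Finset.mem_univ, true_and, Finset.mem_insert]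
    grind

lemma koszulSign_erase {i j : Fin n} {τ : Finset (Fin n)} (hi : i ∈ τ) :
    koszulSign R j (τ.erase i) = koszulSign R j τ * if i < j then -1 else 1 := by
  rw [koszulSign_insert (Finset.notMem_erase i τ), Finset.insert_erase hi]

lemma koszulSign_erase_self {j : Fin n} {τ : Finset (Fin n)} (hj : j ∈ τ) :
    koszulSign R j (τ.erase j) = koszulSign R j τ := by
  simp [koszulSign_erase hj]

lemma koszulSign_anticomm {i j : Fin n} {τ : Finset (Fin n)} (hij : i ≠ j) (hi : i ∈ τ)
    (hj : j ∈ τ) : koszulSign R j τ * koszulSign R i (τ.erase j) =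
      -(koszulSign R i τ * koszulSign R j (τ.erase i)) := by
  rw [koszulSign_erase hi, koszulSign_erase hj]
  rcases lt_or_gt_of_ne hij with h | h
  · simp [h, h.not_gt, mul_comm]
  · simp [h, h.not_gt, mul_comm]

lemma koszulSign_anticomm_insert {i j : Fin n} {τ : Finset (Fin n)} (hij : i ≠ j) (hi : i ∉ τ)
    (hj : j ∈ τ) : koszulSign R i τ * koszulSign R j (insert i τ) =
      -(koszulSign R j τ * koszulSign R i (τ.erase j)) := by
  rw [koszulSign_erase hj, koszulSign_insert (j := j) hi]
  rcases lt_or_gt_of_ne hij with h | h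
  · simp [h, h.not_gt, mul_comm]
  · simp [h, h.not_gt, mul_comm]

lemma koszulD_koszulD (x : Fin n → R) (φ : Finset (Fin n) → M) :
    koszulD x (koszulD x φ) = 0 := by
  funext τ
  have key : koszulD x (koszulD x φ) τ = ∑ p : Fin n × Fin n,
      if p.1 ∈ τ ∧ p.2 ∈ τ ∧ p.2 ≠ p.1 then
        (koszulSign R p.1 τ * koszulSign R p.2 (τ.erase p.1) * (x p.1 * x p.2)) •
          φ ((τ.erase p.1).erase p.2) else 0 := by
    rw [Fintype.sum_prod_type]
    refine Finset.sum_congr rfl fun j _ => ?_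
    by_cases hj : j ∈ τ
    · rw [if_pos hj, koszulD, Finset.smul_sum]
      refine Finset.sum_congr rfl fun i _ => ?_
      by_cases hi : i ∈ τ ∧ i ≠ j
      · rw [if_pos (by simp [hi.1, hi.2]), if_pos ⟨hj, hi⟩, smul_smul]
        congr 1
        ring
      · rw [if_neg (by simpa [and_comm] using hi), if_neg (fun h => hi h.2), smul_zero]
    · simp [hj]
  rw [key, Pi.zero_apply]
  refine Finset.sum_involution (fun p _ => p.swap) ?_ ?_ (by simp) (by simp)
  · rintro ⟨j, i⟩ -
    by_cases h : j ∈ τ ∧ i ∈ τ ∧ i ≠ j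
    · obtain ⟨hj, hi, hij⟩ := h
      simp only [Prod.swap]
      rw [if_pos ⟨hj, hi, hij⟩, if_pos ⟨hi, hj, hij.symm⟩, koszulSign_anticomm hij hi hj,
        Finset.erase_right_comm, mul_comm (x j), neg_mul, neg_smul, neg_add_cancel]
    · simp only [Prod.swap]
      rw [if_neg h, if_neg (by grind), add_zero]
  · rintro ⟨j, i⟩ - h heq
    simp only [Prod.swap, Prod.mk.injEq] at heq
    simp [heq.1] at h

lemma koszulD_homotopy (x a : Fin n → R) (φ : Finset (Fin n) → M) (τ : Finset (Fin n)) :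
    koszulD x (koszulHomotopy a φ) τ + koszulHomotopy a (koszulD x φ) τ =
      (∑ j, a j * x j) • φ τ := by
  simp only [koszulD, koszulHomotopy, Finset.smul_sum, Finset.sum_smul]
  have h1 : (∑ j, if j ∈ τ then (koszulSign R j τ * x j) •
        (∑ i, if i ∈ τ.erase j then 0 else
          (koszulSign R i (τ.erase j) * a i) • φ (insert i (τ.erase j))) else 0) =
      ∑ j, ∑ i, if j ∈ τ ∧ i ∉ τ.erase j then
        (koszulSign R j τ * koszulSign R i (τ.erase j) * (x j * a i)) •
          φ (insert i (τ.erase j)) else 0 := by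
    refine Finset.sum_congr rfl fun j _ => ?_
    by_cases hj : j ∈ τ
    · rw [if_pos hj, Finset.smul_sum]
      refine Finset.sum_congr rfl fun i _ => ?_
      by_cases hi : i ∈ τ.erase j
      · rw [if_pos hi, if_neg (fun h => h.2 hi), smul_zero]
      · rw [if_neg hi, if_pos ⟨hj, hi⟩, smul_smul]
        congr 1
        ring
    · simp [hj]
  have h2 : (∑ i, if i ∈ τ then 0 else (koszulSign R i τ * a i) •
        (∑ j, if j ∈ insert i τ then
          (koszulSign R j (insert i τ) * x j) • φ ((insert i τ).erase j) else 0)) =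
      ∑ j, ∑ i, if i ∉ τ ∧ j ∈ insert i τ then
        (koszulSign R i τ * koszulSign R j (insert i τ) * (x j * a i)) •
          φ ((insert i τ).erase j) else 0 := by
    rw [Finset.sum_comm]
    refine Finset.sum_congr rfl fun i _ => ?_
    by_cases hi : i ∈ τ
    · simp [hi]
    · rw [if_neg hi, Finset.smul_sum]
      refine Finset.sum_congr rfl fun j _ => ?_
      by_cases hj : j ∈ insert i τ
      · rw [if_pos hj, if_pos ⟨hi, hj⟩, smul_smul]
        congr 1
        ring
      · rw [if_neg hj, if_neg (fun h => hj h.2), smul_zero]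
  simp only [Finset.smul_sum] at h1 h2
  rw [h1, h2, ← Finset.sum_add_distrib]
  refine Finset.sum_congr rfl fun j _ => ?_
  rw [← Finset.sum_add_distrib, Finset.sum_eq_single j]
  · by_cases hj : j ∈ τ
    · rw [if_pos ⟨hj, Finset.notMem_erase j τ⟩, if_neg (fun h => h.1 hj), add_zero,
        koszulSign_erase_self hj, koszulSign_mul_self, one_mul, Finset.insert_erase hj, mul_comm]
    · have h : koszulSign R j (insert j τ) = koszulSign R j τ := by
        rw [koszulSign_insert (j := j) hj]; simp
      rw [if_neg (fun h => hj h.1), if_pos ⟨hj, Finset.mem_insert_self j τ⟩, zero_add, h,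
        koszulSign_mul_self, one_mul, Finset.erase_insert hj, mul_comm]
  · intro i _ hij
    by_cases h : j ∈ τ ∧ i ∉ τ
    · rw [if_pos ⟨h.1, fun h' => h.2 (Finset.mem_of_mem_erase h')⟩,
        if_pos ⟨h.2, Finset.mem_insert_of_mem h.1⟩, koszulSign_anticomm_insert hij h.2 h.1,
        Finset.erase_insert_of_ne hij, neg_mul, neg_smul, add_neg_cancel]
    · rw [if_neg (by grind), if_neg (by grind), add_zero]
  · simp

lemma koszulD_smul (x : Fin n → R) (c : R) (φ : Finset (Fin n) → M) :
    koszulD x (c • φ) = c • koszulD x φ := by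
  funext τ
  simp only [koszulD, Pi.smul_apply, Finset.smul_sum]
  refine Finset.sum_congr rfl fun j _ => ?_
  split_ifs
  · rw [smul_comm]
  · rw [smul_zero]

lemma koszulD_add (x : Fin n → R) (φ ψ : Finset (Fin n) → M) :
    koszulD x (φ + ψ) = koszulD x φ + koszulD x ψ := by
  funext τ
  simp only [koszulD, Pi.add_apply, ← Finset.sum_add_distrib]
  refine Finset.sum_congr rfl fun j _ => ?_
  split_ifs
  · rw [smul_add]
  · rw [add_zero]

lemma koszulD_map {N : Type*} [AddCommGroup N] [Module R N] (L : M →ₗ[R] N) (x : Fin n → R)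
    (φ : Finset (Fin n) → M) (τ : Finset (Fin n)) :
    koszulD x (fun σ => L (φ σ)) τ = L (koszulD x φ τ) := by
  simp only [koszulD, map_sum]
  refine Finset.sum_congr rfl fun j _ => ?_
  split_ifs
  · rw [map_smul]
  · rw [map_zero]

open RingTheory.Sequence in
/-- Depth sensitivity of the Koszul complex: a cocycle supported in degrees below the length of
a weakly regular sequence from `(x_1, …, x_n)` is a coboundary. -/
theorem exists_koszulD_eq_of_isWeaklyRegular (x : Fin n → R) (rs : List R) :
    ∀ {M : Type*} [AddCommGroup M] [Module R M] (_ : IsWeaklyRegular M rs)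
      (_ : ∀ r ∈ rs, r ∈ Ideal.span (Set.range x)) (φ : Finset (Fin n) → M)
      (_ : ∀ τ, rs.length ≤ τ.card → φ τ = 0) (_ : koszulD x φ = 0),
      ∃ ψ, koszulD x ψ = φ := by
  induction rs with
  | nil =>
    intro M _ _ _ _ φ hφ _
    obtain rfl : φ = 0 := funext fun τ => hφ τ (by simp)
    exact ⟨0, funext fun τ => by simp [koszulD]⟩
  | cons r rs ih =>
    intro M _ _ hreg hmem φ hφ hD
    obtain ⟨hr, hrs⟩ := (isWeaklyRegular_cons_iff M r rs).1 hreg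
    obtain ⟨a, ha⟩ := Ideal.mem_span_range_iff_exists_fun.1 (hmem r (by simp))
    set ψ := koszulHomotopy a φ with hψ
    have hDψ : koszulD x ψ = r • φ := by
      funext τ
      have h := koszulD_homotopy x a φ τ
      rw [hD, ha] at h
      simpa [koszulHomotopy] using h
    let π : M →ₗ[R] QuotSMulTop r M := Submodule.mkQ _
    have hπ : ∀ m, π m = 0 ↔ ∃ m', r • m' = m := fun m => by
      simp [π, Submodule.mem_smul_pointwise_iff_exists]
    obtain ⟨η, hη⟩ := ih hrs (fun r' h => hmem r' (by simp [h])) (fun σ => π (ψ σ))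
      (fun τ hτ => by
        have : ψ τ = 0 := Finset.sum_eq_zero fun j _ => by
          split_ifs with hj
          · rfl
          · rw [hφ, smul_zero]
            simpa [Finset.card_insert_of_notMem hj] using hτ
        rw [this, map_zero])
      (funext fun τ => by
        rw [koszulD_map, hDψ, Pi.zero_apply, hπ]
        exact ⟨φ τ, rfl⟩)
    choose η' hη' using fun τ => Submodule.mkQ_surjective _ (η τ)
    have hlift : ∀ τ, ∃ m, r • m = ψ τ - koszulD x η' τ := fun τ => by
      rw [← hπ, map_sub, sub_eq_zero, ← koszulD_map]
      have : (fun σ => π (η' σ)) = η := funext hη'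
      rw [this, hη]
    choose ψ' hψ' using hlift
    have hdecomp : ψ = koszulD x η' + r • ψ' := funext fun τ => by
      simp [hψ']
    refine ⟨ψ', funext fun τ => hr ?_⟩
    have := congrFun hDψ τ
    rw [hdecomp, koszulD_add, koszulD_koszulD, koszulD_smul, zero_add] at this
    exact this

end Koszul

section Squarefree

variable {n : ℕ}

/-- The exponent vector of the squarefree monomial with support `τ`. -/
noncomputable def sqfreeExp (τ : Finset (Fin n)) : Fin n →₀ ℕ :=
  Finsupp.equivFunOnFinite.symm fun j => if j ∈ τ then 1 else 0

@[simp] lemma sqfreeExp_apply (τ : Finset (Fin n)) (j : Fin n) :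
    sqfreeExp τ j = if j ∈ τ then 1 else 0 := rfl

lemma sqfreeExp_injective : Function.Injective (sqfreeExp (n := n)) := by
  intro σ τ h
  ext j
  have := DFunLike.congr_fun h j
  simp only [sqfreeExp_apply] at this
  grind

lemma isSqfree_sqfreeExp (τ : Finset (Fin n)) : IsSqfree (sqfreeExp τ) := fun j => by
  rw [sqfreeExp_apply]; split_ifs <;> simp

lemma mdeg_sqfreeExp (τ : Finset (Fin n)) : mdeg (sqfreeExp τ) = τ.card := by
  simp [mdeg, Finsupp.sum_fintype]

lemma IsSqfree.sqfreeExp_support {m : Fin n →₀ ℕ} (hm : IsSqfree m) :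
    sqfreeExp m.support = m := by
  ext j
  have := hm j
  by_cases h : m j = 0
  · simp [h]
  · simp [h]; omega

lemma sqfreeExp_erase_add {j : Fin n} {τ : Finset (Fin n)} (hj : j ∈ τ) :
    sqfreeExp (τ.erase j) + Finsupp.single j 1 = sqfreeExp τ := by
  ext l
  by_cases h : l = j
  · subst h; simp [hj]
  · simp [h, Finsupp.single_eq_of_ne h]

lemma sqfreeExp_eq_add_single_iff {j : Fin n} {σ τ : Finset (Fin n)} :
    sqfreeExp τ = sqfreeExp σ + Finsupp.single j 1 ↔ j ∈ τ ∧ σ = τ.erase j := by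
  constructor
  · intro h
    have hj : j ∈ τ := by
      by_contra hj
      have := DFunLike.congr_fun h j
      simp [hj] at this
    refine ⟨hj, sqfreeExp_injective ?_⟩
    rw [← sqfreeExp_erase_add hj] at h
    exact (add_right_cancel h).symm
  · rintro ⟨hj, rfl⟩
    exact (sqfreeExp_erase_add hj).symm

lemma kSign_sqfreeExp (K : Type*) [Field K] (σ τ : Finset (Fin n)) :
    kSign K (sqfreeExp σ) (sqfreeExp τ) =
      ∑ j, if j ∈ τ ∧ σ = τ.erase j then koszulSign K j τ else 0 := by
  unfold kSign
  split_ifs with h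
  · have hc := sqfreeExp_eq_add_single_iff.1 h.choose_spec
    generalize h.choose = j at hc
    obtain ⟨hj, rfl⟩ := hc
    rw [Finset.sum_eq_single j]
    · rw [if_pos ⟨hj, rfl⟩, koszulSign]
      congr 2
      ext l
      simp only [Finset.mem_filter, Finset.mem_univ, true_and, sqfreeExp_apply]
      grind
    · intro i _ hij
      refine if_neg fun ⟨hi, he⟩ => Finset.notMem_erase i τ ?_
      rw [← he]
      exact Finset.mem_erase.2 ⟨hij, hi⟩
    · simp
  · refine (Finset.sum_eq_zero fun j _ => if_neg fun hj => h ⟨j, ?_⟩).symm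
    exact sqfreeExp_eq_add_single_iff.2 hj

lemma sum_kSign_mul_eq_koszulD {K ι : Type*} [Field K] [Fintype ι]
    {F : ι → Finset (Fin n)} (hF : Function.Injective F) (v : ι → K) (τ : Finset (Fin n)) :
    ∑ q, kSign K (sqfreeExp (F q)) (sqfreeExp τ) * v q =
      koszulD (1 : Fin n → K) (Function.extend F v 0) τ := by
  simp only [kSign_sqfreeExp, Finset.sum_mul, koszulD]
  rw [Finset.sum_comm]
  refine Finset.sum_congr rfl fun j _ => ?_
  by_cases hj : j ∈ τ
  · simp only [hj, true_and, if_true, Pi.one_apply, mul_one, smul_eq_mul]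
    by_cases h : ∃ q, F q = τ.erase j
    · obtain ⟨q, hq⟩ := h
      rw [← hq, hF.extend_apply, Finset.sum_eq_single q]
      · simp
      · intro p _ hp
        rw [if_neg (fun h => hp (hF h)), zero_mul]
      · simp
    · rw [Function.extend_apply' _ _ _ h, Pi.zero_apply, mul_zero]
      refine Finset.sum_eq_zero fun q _ => ?_
      rw [if_neg (fun hq => h ⟨q, hq⟩), zero_mul]
  · simp [hj]

lemma koszulD_congr {R M : Type*} [CommRing R] [AddCommGroup M] [Module R M] {x : Fin n → R}
    {φ ψ : Finset (Fin n) → M} {τ : Finset (Fin n)}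
    (h : ∀ j ∈ τ, φ (τ.erase j) = ψ (τ.erase j)) : koszulD x φ τ = koszulD x ψ τ := by
  refine Finset.sum_congr rfl fun j _ => ?_
  split_ifs with hj
  · rw [h j hj]
  · rfl

lemma koszulD_eq_zero {R M : Type*} [CommRing R] [AddCommGroup M] [Module R M] {x : Fin n → R}
    {φ : Finset (Fin n) → M} {τ : Finset (Fin n)}
    (h : ∀ j ∈ τ, φ (τ.erase j) = 0) : koszulD x φ τ = 0 := by
  refine Finset.sum_eq_zero fun j _ => ?_
  split_ifs with hj
  · rw [h j hj, smul_zero]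
  · rfl

end Squarefree

section MonomialIdeal

variable {K : Type*} [Field K] {n : ℕ}

lemma GenSqfreeGe.monomial_mem {d : ℕ} {I : Ideal (MvPolynomial (Fin n) K)}
    (hI : GenSqfreeGe K d I) {p : MvPolynomial (Fin n) K} (hp : p ∈ I) {m : Fin n →₀ ℕ}
    (hm : coeff m p ≠ 0) : monomial m (1 : K) ∈ I := by
  obtain ⟨G, -, rfl⟩ := hI
  obtain ⟨g, hg, hle⟩ := mem_ideal_span_monomial_image.1 hp m (mem_support_iff.2 hm)
  refine mem_ideal_span_monomial_image.2 fun m' hm' => ⟨g, hg, ?_⟩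
  obtain rfl : m = m' := by
    by_contra hne
    simp [hne] at hm'
  exact hle

lemma X_mul_monomial_sqfreeExp_erase {j : Fin n} {τ : Finset (Fin n)} (hj : j ∈ τ) :
    X j * monomial (sqfreeExp (τ.erase j)) (1 : K) = monomial (sqfreeExp τ) 1 := by
  rw [X, monomial_mul, add_comm, sqfreeExp_erase_add hj, mul_one]

lemma monomial_sqfreeExp_mem_of_erase {I : Ideal (MvPolynomial (Fin n) K)} {j : Fin n}
    {τ : Finset (Fin n)} (hj : j ∈ τ) (h : monomial (sqfreeExp (τ.erase j)) (1 : K) ∈ I) :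
    monomial (sqfreeExp τ) (1 : K) ∈ I := by
  rw [← X_mul_monomial_sqfreeExp_erase hj]
  exact I.mul_mem_left _ h

lemma coeff_koszulD_X (P : Finset (Fin n) → MvPolynomial (Fin n) K) (τ : Finset (Fin n)) :
    coeff (sqfreeExp τ) (koszulD (X : Fin n → MvPolynomial (Fin n) K) P τ) =
      koszulD (1 : Fin n → K) (fun σ => coeff (sqfreeExp σ) (P σ)) τ := by
  simp only [koszulD, coeff_sum]
  refine Finset.sum_congr rfl fun j _ => ?_
  split_ifs with hj
  · have h : koszulSign (MvPolynomial (Fin n) K) j τ = C (koszulSign K j τ) := by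
      simp [koszulSign]
    rw [h, smul_eq_mul, mul_assoc, coeff_C_mul, ← sqfreeExp_erase_add hj, add_comm,
      coeff_X_mul, Pi.one_apply, mul_one, smul_eq_mul]
  · simp

open Classical in
/-- The class of the squarefree monomial with support `τ` in `I/J`, or `0` outside `I`. -/
noncomputable def sqfreeClass (I J : Ideal (MvPolynomial (Fin n) K)) (τ : Finset (Fin n)) :
    quotMod I J :=
  if h : monomial (sqfreeExp τ) (1 : K) ∈ I then Submodule.Quotient.mk ⟨_, h⟩ else 0

lemma sqfreeClass_of_mem {I J : Ideal (MvPolynomial (Fin n) K)} {τ : Finset (Fin n)}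
    (h : monomial (sqfreeExp τ) (1 : K) ∈ I) :
    sqfreeClass I J τ = Submodule.Quotient.mk ⟨_, h⟩ := dif_pos h

lemma sqfreeClass_eq_zero {I J : Ideal (MvPolynomial (Fin n) K)} {τ : Finset (Fin n)}
    (h : monomial (sqfreeExp τ) (1 : K) ∈ I → monomial (sqfreeExp τ) (1 : K) ∈ J) :
    sqfreeClass I J τ = 0 := by
  by_cases hI : monomial (sqfreeExp τ) (1 : K) ∈ I
  · rw [sqfreeClass_of_mem hI, Submodule.Quotient.mk_eq_zero]
    exact h hI
  · exact dif_neg hI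

lemma koszulD_X_smul_sqfreeClass {I J : Ideal (MvPolynomial (Fin n) K)}
    {w : Finset (Fin n) → K} (hw : ∀ τ, w τ ≠ 0 → monomial (sqfreeExp τ) (1 : K) ∈ I)
    (τ : Finset (Fin n)) :
    koszulD (X : Fin n → MvPolynomial (Fin n) K)
      (fun σ => (C (w σ) : MvPolynomial (Fin n) K) • sqfreeClass I J σ) τ =
      (C (koszulD (1 : Fin n → K) w τ) : MvPolynomial (Fin n) K) • sqfreeClass I J τ := by
  simp only [koszulD, map_sum, Finset.sum_smul]
  refine Finset.sum_congr rfl fun j _ => ?_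
  split_ifs with hj
  · by_cases h0 : w (τ.erase j) = 0
    · simp [h0]
    · have hI := hw _ h0
      have hX : (X j : MvPolynomial (Fin n) K) • sqfreeClass I J (τ.erase j) =
          sqfreeClass I J τ := by
        rw [sqfreeClass_of_mem hI, sqfreeClass_of_mem (monomial_sqfreeExp_mem_of_erase hj hI),
          ← Submodule.Quotient.mk_smul]
        congr 1
        exact Subtype.ext (X_mul_monomial_sqfreeExp_erase hj)
      rw [← hX, smul_smul, smul_smul]
      congr 1
      simp [koszulSign]
      ring
  · simp

end MonomialIdeal

section Enumeration

variable {K : Type*} [Field K] {n : ℕ}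

lemma exists_sqfreeExp_enumeration {I J : Ideal (MvPolynomial (Fin n) K)} {r t : ℕ}
    {f : Fin r → (Fin n →₀ ℕ)}
    (hf : Function.Injective f ∧ Set.range f =
      {m : Fin n →₀ ℕ | IsSqfree m ∧ mdeg m = t ∧
        monomial m (1 : K) ∈ I ∧ monomial m (1 : K) ∉ J}) :
    ∃ F : Fin r → Finset (Fin n), Function.Injective F ∧ (∀ q, f q = sqfreeExp (F q)) ∧
      ∀ τ, (∃ q, F q = τ) ↔ τ.card = t ∧ monomial (sqfreeExp τ) (1 : K) ∈ I ∧
        monomial (sqfreeExp τ) (1 : K) ∉ J := by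
  have hmem : ∀ m, m ∈ Set.range f ↔ IsSqfree m ∧ mdeg m = t ∧
      monomial m (1 : K) ∈ I ∧ monomial m (1 : K) ∉ J := fun m => by rw [hf.2]; rfl
  have hF : ∀ q, f q = sqfreeExp (f q).support := fun q =>
    (((hmem _).1 ⟨q, rfl⟩).1.sqfreeExp_support).symm
  refine ⟨fun q => (f q).support, fun p q h => hf.1 ?_, hF, fun τ => ?_⟩
  · rw [hF p, hF q]
    exact congrArg sqfreeExp h
  · rw [← mdeg_sqfreeExp]
    refine Iff.trans ?_ ((hmem _).trans (and_iff_right (isSqfree_sqfreeExp τ)))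
    refine exists_congr fun q => ?_
    rw [← sqfreeExp_injective.eq_iff, ← hF]

lemma exists_weaklyRegular_of_lt_mdepth {M : Type*} [AddCommGroup M]
    [Module (MvPolynomial (Fin n) K) M] {t : ℕ} (h : t < mdepth K n M) :
    ∃ rs : List (MvPolynomial (Fin n) K), t < rs.length ∧
      (∀ r ∈ rs, r ∈ Ideal.span (Set.range (X : Fin n → MvPolynomial (Fin n) K))) ∧
      RingTheory.Sequence.IsWeaklyRegular M rs := by
  unfold mdepth at h
  obtain ⟨k, ⟨rs, rfl, hmem, hreg⟩, hk⟩ := exists_lt_of_lt_csSup (by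
    by_contra hne
    rw [Set.not_nonempty_iff_eq_empty] at hne
    simp [hne] at h) h
  exact ⟨rs, hk, hmem, hreg.toIsWeaklyRegular⟩

end Enumeration

theorem rank_sum {K : Type*} [Field K] {n d i c r s : ℕ}
    (I J : Ideal (MvPolynomial (Fin n) K)) (hJI : J < I)
    (hI : GenSqfreeGe K d I) (hJ : GenSqfreeGe K (d + 1) J)
    (hd : 1 ≤ d) (hi : i < n - d)
    (g : Fin c → (Fin n →₀ ℕ)) (f : Fin r → (Fin n →₀ ℕ)) (b : Fin s → (Fin n →₀ ℕ))
    (hg : Function.Injective g ∧ Set.range g =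
      {m : Fin n →₀ ℕ | IsSqfree m ∧ mdeg m = d + i - 1 ∧
        monomial m (1 : K) ∈ I ∧ monomial m (1 : K) ∉ J})
    (hf : Function.Injective f ∧ Set.range f =
      {m : Fin n →₀ ℕ | IsSqfree m ∧ mdeg m = d + i ∧
        monomial m (1 : K) ∈ I ∧ monomial m (1 : K) ∉ J})
    (hb : Function.Injective b ∧ Set.range b =
      {m : Fin n →₀ ℕ | IsSqfree m ∧ mdeg m = d + i + 1 ∧
        monomial m (1 : K) ∈ I ∧ monomial m (1 : K) ∉ J})
    (hdepth : d + i < mdepth K n (quotMod I J)) :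
    r = (Matrix.of fun (q : Fin r) (p : Fin c) => kSign K (g p) (f q)).rank + (Matrix.of fun (k : Fin s) (q : Fin r) => kSign K (f q) (b k)).rank := by
  obtain ⟨G, hGinj, hG, hGmem⟩ := exists_sqfreeExp_enumeration hg
  obtain ⟨F, hFinj, hF, hFmem⟩ := exists_sqfreeExp_enumeration hf
  obtain ⟨B, -, hB, hBmem⟩ := exists_sqfreeExp_enumeration hb
  set A₁ := (Matrix.of fun (q : Fin r) (p : Fin c) => kSign K (g p) (f q)) with hA₁
  set A₂ := (Matrix.of fun (k : Fin s) (q : Fin r) => kSign K (f q) (b k)) with hA₂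
  have hmul₁ : ∀ u q, A₁.mulVec u q =
      koszulD (1 : Fin n → K) (Function.extend G u 0) (F q) := fun u q => by
    rw [← sum_kSign_mul_eq_koszulD hGinj]
    simp [hA₁, Matrix.mulVec, dotProduct, hG, hF]
  have hmul₂ : ∀ v k, A₂.mulVec v k =
      koszulD (1 : Fin n → K) (Function.extend F v 0) (B k) := fun v k => by
    rw [← sum_kSign_mul_eq_koszulD hFinj]
    simp [hA₂, Matrix.mulVec, dotProduct, hF, hB]
  have hcomp : ∀ u, A₂.mulVec (A₁.mulVec u) = 0 := by
    intro u
    funext k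
    obtain ⟨hcard, -, hJk⟩ := (hBmem _).1 ⟨k, rfl⟩
    rw [hmul₂, koszulD_congr (ψ := koszulD (1 : Fin n → K) (Function.extend G u 0)),
      koszulD_koszulD]
    · rfl
    · intro j hj
      by_cases h : ∃ q, F q = (B k).erase j
      · obtain ⟨q, hq⟩ := h
        rw [← hq, hFinj.extend_apply, hmul₁]
      · rw [Function.extend_apply' _ _ _ h, Pi.zero_apply, koszulD_eq_zero]
        intro l hl
        refine Function.extend_apply' _ _ _ fun hp => h ?_
        refine (hFmem _).2 ⟨by rw [Finset.card_erase_of_mem hj, hcard]; omega,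
          monomial_sqfreeExp_mem_of_erase hl ((hGmem _).1 hp).2.1,
          fun hJ' => hJk (monomial_sqfreeExp_mem_of_erase hj hJ')⟩
  have hexact : ∀ v, A₂.mulVec v = 0 → ∃ u, A₁.mulVec u = v := by
    intro v hv
    set w := Function.extend F v 0 with hw
    have hwF : ∀ τ, w τ ≠ 0 → ∃ q, F q = τ := fun τ h => by
      by_contra hτ
      exact h (Function.extend_apply' _ _ _ hτ)
    obtain ⟨rs, hlen, hrs, hreg⟩ := exists_weaklyRegular_of_lt_mdepth hdepth
    obtain ⟨ψ, hψ⟩ := exists_koszulD_eq_of_isWeaklyRegular X rs hreg hrs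
      (fun σ => (C (w σ) : MvPolynomial (Fin n) K) • sqfreeClass I J σ)
      (fun τ hτ => by
        have : w τ = 0 := by
          by_contra h
          have := ((hFmem _).1 (hwF τ h)).1
          omega
        simp [this])
      (funext fun τ => by
        rw [koszulD_X_smul_sqfreeClass fun τ h => ((hFmem _).1 (hwF τ h)).2.1, Pi.zero_apply]
        by_cases hΔ : monomial (sqfreeExp τ) (1 : K) ∈ I → monomial (sqfreeExp τ) (1 : K) ∈ J
        · rw [sqfreeClass_eq_zero hΔ, smul_zero]
        · push Not at hΔ
          have : koszulD (1 : Fin n → K) w τ = 0 := by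
            by_cases hτ : τ.card = d + i + 1
            · obtain ⟨k, rfl⟩ := (hBmem τ).2 ⟨hτ, hΔ⟩
              rw [← hmul₂, hv, Pi.zero_apply]
            · refine koszulD_eq_zero fun j hj => ?_
              by_contra h
              have h1 := ((hFmem _).1 (hwF _ h)).1
              have h2 := Finset.card_erase_add_one hj
              omega
          rw [this, C_0, zero_smul])
    choose P hP using fun τ => Submodule.Quotient.mk_surjective _ (ψ τ)
    set u' : Finset (Fin n) → K := fun σ => coeff (sqfreeExp σ) (P σ : MvPolynomial (Fin n) K)
      with hu'
    refine ⟨fun p => u' (G p), funext fun q => ?_⟩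
    obtain ⟨hcard, hIq, hJq⟩ := (hFmem _).1 ⟨q, rfl⟩
    have hD : koszulD (1 : Fin n → K) u' (F q) = v q := by
      have h := congrFun hψ (F q)
      rw [sqfreeClass_of_mem hIq, hw, hFinj.extend_apply,
        show ψ = fun σ => Submodule.mkQ _ (P σ) from (funext hP).symm, koszulD_map,
        ← Submodule.Quotient.mk_smul, Submodule.mkQ_apply, Submodule.Quotient.eq,
        Submodule.mem_comap, map_sub, ← koszulD_map] at h
      by_contra hne
      refine hJq (hJ.monomial_mem h ?_)
      simp only [Submodule.subtype_apply]
      rw [coeff_sub, coeff_koszulD_X, Submodule.coe_smul, smul_eq_mul, coeff_C_mul,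
        coeff_monomial, if_pos rfl, mul_one]
      exact sub_ne_zero.2 hne
    rw [hmul₁, ← hD]
    refine koszulD_congr fun j hj => ?_
    by_cases h : ∃ p, G p = (F q).erase j
    · obtain ⟨p, hp⟩ := h
      rw [← hp, hGinj.extend_apply]
    · rw [Function.extend_apply' _ _ _ h, Pi.zero_apply]
      by_contra hne
      refine h ((hGmem _).2 ⟨by rw [Finset.card_erase_of_mem hj, hcard],
        hI.monomial_mem (P _).2 (Ne.symm hne),
        fun hJ' => hJq (monomial_sqfreeExp_mem_of_erase hj hJ')⟩)
  have hker : LinearMap.ker A₂.mulVecLin = LinearMap.range A₁.mulVecLin := by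
    ext v
    simp only [LinearMap.mem_ker, LinearMap.mem_range, Matrix.mulVecLin_apply]
    exact ⟨hexact v, by rintro ⟨u, rfl⟩; exact hcomp u⟩
  have hrn := LinearMap.finrank_range_add_finrank_ker A₂.mulVecLin
  rw [hker, Module.finrank_fin_fun] at hrn
  rw [Matrix.rank, Matrix.rank, add_comm]
  exact hrn.symm
end

section
/- Let J ⊊ I be square-free monomial ideals of S = K[x_1,...,x_n] with I generated in degrees ≥ d and J in degrees ≥ d+1. If depth_S(I/J) ≥ d+2 and ρ_{d+2}(I\J) = 0, then ρ_d(I) = ρ_{d+1}(I\J). -/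
open MvPolynomial

section RegularSequence

variable {R : Type*} [CommRing R] [IsNoetherianRing R]

open scoped Pointwise in
/-- If `x` is regular on `M` and `P` is an associated prime of `M` inside a prime `m ∋ x`, then
`M / xM` has an associated prime inside `m` strictly above `P`. -/
theorem exists_isAssociatedPrime_quotSMulTop_gt {M : Type*} [AddCommGroup M] [Module R M]
    [Module.Finite R M] {m P : Ideal R} [m.IsPrime] (hP : IsAssociatedPrime P M) (hPm : P ≤ m)
    {x : R} (hxm : x ∈ m) (hx : IsSMulRegular M x) :
    ∃ Q : Ideal R, IsAssociatedPrime Q (QuotSMulTop x M) ∧ Q ≤ m ∧ P < Q := by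
  obtain ⟨-, z, hz⟩ := isAssociatedPrime_iff.mp hP
  have hann (r : R) : r ∈ P ↔ r • z = 0 := by
    rw [hz, Submodule.mem_colon_singleton, Submodule.mem_bot]
  let U : Submodule R M := Submodule.torsionBySet R M P
  have hzU : z ∈ U := (Submodule.mem_torsionBySet_iff _ _).mpr fun a => (hann a).mp a.2
  have hmem : (⟨m, ‹_›⟩ : PrimeSpectrum R) ∈ Module.support R (QuotSMulTop x U) := by
    rw [Module.support_quotSMulTop]
    refine ⟨Module.mem_support_iff_of_finite.mpr fun r hr => hPm ?_, by simpa using hxm⟩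
    rw [hann]
    exact congrArg Subtype.val (Module.mem_annihilator.mp hr (⟨z, hzU⟩ : U))
  obtain ⟨Q, hQ, hQm⟩ := Ideal.exists_minimalPrimes_le (Module.mem_support_iff_of_finite.mp hmem)
  have hinj : Function.Injective (QuotSMulTop.map x U.subtype) := by
    rw [injective_iff_map_eq_zero]
    intro u hu
    obtain ⟨u, rfl⟩ := Submodule.Quotient.mk_surjective _ u
    rw [QuotSMulTop.map_apply_mk, Submodule.Quotient.mk_eq_zero,
      Submodule.mem_smul_pointwise_iff_exists] at hu
    obtain ⟨v, -, hv⟩ := hu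
    rw [Submodule.Quotient.mk_eq_zero, Submodule.mem_smul_pointwise_iff_exists]
    refine ⟨⟨v, (Submodule.mem_torsionBySet_iff _ _).mpr fun a => hx ?_⟩, trivial,
      Subtype.ext hv⟩
    change x • (a : R) • v = x • (0 : M)
    rw [smul_comm, hv, smul_zero]
    exact (Submodule.mem_torsionBySet_iff _ _).mp u.2 a
  refine ⟨Q, IsAssociatedPrime.map_of_injective _
    (Module.associatedPrimes.minimalPrimes_annihilator_subset_associatedPrimes R _ hQ) hinj, hQm, ?_⟩
  have hxQ : x ∈ Q := hQ.1.2 (QuotSMulTop.mem_annihilator _ x)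
  refine lt_of_le_of_ne (fun a ha => hQ.1.2 (Module.mem_annihilator.mpr fun u => ?_)) ?_
  · obtain ⟨u, rfl⟩ := Submodule.Quotient.mk_surjective _ u
    rw [← Submodule.Quotient.mk_smul,
      show a • u = 0 from Subtype.ext ((Submodule.mem_torsionBySet_iff _ _).mp u.2 ⟨a, ha⟩),
      Submodule.Quotient.mk_zero]
  · rintro rfl
    have h0 : z = 0 := hx (((hann x).mp hxQ).trans (smul_zero x).symm)
    exact hP.isPrime.ne_top ((Ideal.eq_top_iff_one _).mpr ((hann 1).mpr (by rw [h0, smul_zero])))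

/-- The length of a weakly regular sequence inside `m` is at most `dim R/P` for every associated
prime `P ≤ m`. -/
theorem length_le_coheight_of_isWeaklyRegular {m : Ideal R} [m.IsPrime] (rs : List R)
    (hrs : ∀ r ∈ rs, r ∈ m) {M : Type*} [AddCommGroup M] [Module R M] [Module.Finite R M]
    (hreg : RingTheory.Sequence.IsWeaklyRegular M rs) {P : Ideal R} (hP : IsAssociatedPrime P M)
    (hPm : P ≤ m) :
    (rs.length : ℕ∞) ≤ Order.coheight (⟨P, hP.isPrime⟩ : PrimeSpectrum R) := by
  induction rs generalizing M P with
  | nil => simp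
  | cons x rs ih =>
    rw [RingTheory.Sequence.isWeaklyRegular_cons_iff] at hreg
    obtain ⟨Q, hQ, hQm, hPQ⟩ := exists_isAssociatedPrime_quotSMulTop_gt hP hPm
      (hrs x List.mem_cons_self) hreg.1
    have h := ih (fun r hr => hrs r (List.mem_cons_of_mem _ hr)) hreg.2 hQ hQm
    have hlt : (⟨P, hP.isPrime⟩ : PrimeSpectrum R) < ⟨Q, hQ.isPrime⟩ := hPQ
    rw [List.length_cons, Nat.cast_add, Nat.cast_one]
    exact (add_le_add_left h 1).trans (Order.coheight_add_one_le hlt)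

theorem length_le_ringKrullDim_quotient_of_isWeaklyRegular {m : Ideal R} [m.IsPrime] (rs : List R)
    (hrs : ∀ r ∈ rs, r ∈ m) {M : Type*} [AddCommGroup M] [Module R M] [Module.Finite R M]
    (hreg : RingTheory.Sequence.IsWeaklyRegular M rs) {P : Ideal R} (hP : IsAssociatedPrime P M)
    (hPm : P ≤ m) :
    (rs.length : WithBot ℕ∞) ≤ ringKrullDim (R ⧸ P) := by
  have hset : PrimeSpectrum.zeroLocus (P : Set R) = Set.Ici ⟨P, hP.isPrime⟩ := rfl
  rw [ringKrullDim_quotient, hset, ← Order.coheight_eq_krullDim_Ici]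
  exact WithBot.coe_le_coe.mpr (length_le_coheight_of_isWeaklyRegular rs hrs hreg hP hPm)

end RegularSequence

section CoordinateIdeal

variable (K : Type*) [Field K] {σ : Type*}

open Classical in
/-- The evaluation at `0` of the variables outside `F`. -/
noncomputable def restrictVars (F : Set σ) : MvPolynomial σ K →ₐ[K] MvPolynomial F K :=
  aeval fun i => if h : i ∈ F then X ⟨i, h⟩ else 0

theorem restrictVars_comp_rename (F : Set σ) :
    (restrictVars K F).comp (rename Subtype.val) = AlgHom.id K (MvPolynomial F K) := by
  ext i
  simp [restrictVars]

theorem restrictVars_surjective (F : Set σ) : Function.Surjective (restrictVars K F) := fun f =>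
  ⟨rename Subtype.val f, DFunLike.congr_fun (restrictVars_comp_rename K F) f⟩

theorem ker_restrictVars (F : Set σ) :
    RingHom.ker (restrictVars K F) = Ideal.span (X '' Fᶜ) := by
  apply le_antisymm
  · intro f hf
    have h : (Ideal.Quotient.mkₐ K (Ideal.span (X '' Fᶜ : Set (MvPolynomial σ K)))).comp
        ((rename Subtype.val).comp (restrictVars K F)) = Ideal.Quotient.mkₐ K _ := by
      ext i
      by_cases hi : i ∈ F
      · simp [restrictVars, hi]
      · simpa [restrictVars, hi] using (Ideal.Quotient.eq_zero_iff_mem.mpr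
          (Ideal.subset_span (Set.mem_image_of_mem X hi))).symm
    have hf' := DFunLike.congr_fun h f
    rw [AlgHom.comp_apply, AlgHom.comp_apply, (RingHom.mem_ker).mp hf, map_zero, map_zero] at hf'
    exact Ideal.Quotient.eq_zero_iff_mem.mp hf'.symm
  · rw [Ideal.span_le]
    rintro _ ⟨i, hi, rfl⟩
    simp [restrictVars, show i ∉ F from hi]

theorem isPrime_span_X_image_compl (F : Set σ) :
    (Ideal.span (X '' Fᶜ : Set (MvPolynomial σ K))).IsPrime := by
  rw [← ker_restrictVars]
  exact RingHom.ker_isPrime _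

theorem ringKrullDim_quotient_span_X_image_compl [Finite σ] (F : Set σ) :
    ringKrullDim (MvPolynomial σ K ⧸ Ideal.span (X '' Fᶜ : Set (MvPolynomial σ K))) =
      (F.ncard : WithBot ℕ∞) := by
  rw [← ker_restrictVars, ringKrullDim_eq_of_ringEquiv
    (Ideal.quotientKerAlgEquivOfSurjective (restrictVars_surjective K F)).toRingEquiv,
    MvPolynomial.ringKrullDim_of_isNoetherianRing, ringKrullDim_eq_zero_of_field, zero_add]
  rfl

end CoordinateIdeal

section SqfreeMonomials

variable {K : Type*} [Field K] {n : ℕ}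

theorem mdeg_eq_sum (m : Fin n →₀ ℕ) : mdeg m = ∑ i, m i :=
  Finsupp.sum_fintype _ _ fun _ => rfl

theorem mdeg_mono {m m' : Fin n →₀ ℕ} (h : m ≤ m') : mdeg m ≤ mdeg m' := by
  simp only [mdeg_eq_sum]
  exact Finset.sum_le_sum fun i _ => h i

theorem mdeg_add_single (m : Fin n →₀ ℕ) (i : Fin n) :
    mdeg (m + Finsupp.single i 1) = mdeg m + 1 := by
  simp [mdeg_eq_sum, Finset.sum_add_distrib, Finsupp.single_apply]

theorem IsSqfree.ncard_support {m : Fin n →₀ ℕ} (hm : IsSqfree m) :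
    Set.ncard {i | m i ≠ 0} = mdeg m := by
  have hsum : mdeg m = ∑ i, if m i ≠ 0 then 1 else 0 := by
    rw [mdeg_eq_sum]
    refine Finset.sum_congr rfl fun i _ => ?_
    have := hm i
    split_ifs <;> lia
  rw [hsum, ← Finset.card_filter, ← Set.ncard_coe_finset, Finset.coe_filter_univ]

theorem IsSqfree.add_single {m : Fin n →₀ ℕ} (hm : IsSqfree m) {i : Fin n} (hi : m i = 0) :
    IsSqfree (m + Finsupp.single i 1) := by
  intro j
  rcases eq_or_ne i j with rfl | hij
  · simp [hi]
  · simpa [Finsupp.single_apply, hij] using hm j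

theorem finite_setOf_isSqfree : {m : Fin n →₀ ℕ | IsSqfree m}.Finite := by
  refine (Set.finite_Iic (Finsupp.equivFunOnFinite.symm fun _ => 1)).subset fun m hm j => ?_
  simpa using hm j

theorem rho_eq_zero_iff {I J : Ideal (MvPolynomial (Fin n) K)} {t : ℕ} :
    rho K I J t = 0 ↔ ∀ m : Fin n →₀ ℕ, IsSqfree m → mdeg m = t → monomial m (1 : K) ∈ I →
      monomial m (1 : K) ∈ J := by
  rw [rho, Set.ncard_eq_zero (finite_setOf_isSqfree.subset fun m hm => hm.1),
    Set.eq_empty_iff_forall_notMem]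
  simp only [Set.mem_ofPred_eq, not_and, not_not]

theorem GenSqfreeGe.le_mdeg_of_monomial_mem {d : ℕ} {I : Ideal (MvPolynomial (Fin n) K)}
    (hI : GenSqfreeGe K d I) {m : Fin n →₀ ℕ} (h : monomial m (1 : K) ∈ I) : d ≤ mdeg m := by
  obtain ⟨G, hG, rfl⟩ := hI
  obtain ⟨g, hg, hgm⟩ := mem_ideal_span_monomial_image.mp h m (by simp [mem_support_iff])
  exact (hG g hg).2.trans (mdeg_mono hgm)

/-- If `x^w ∉ J` is squarefree and `f x^w ∈ J` then every monomial of `f` involves a variable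
not dividing `x^w`. -/
theorem GenSqfreeGe.mem_span_of_mul_monomial_mem {d : ℕ} {J : Ideal (MvPolynomial (Fin n) K)}
    (hJ : GenSqfreeGe K d J) {w : Fin n →₀ ℕ} (hwJ : monomial w (1 : K) ∉ J)
    {f : MvPolynomial (Fin n) K} (hf : f * monomial w 1 ∈ J) :
    f ∈ Ideal.span (X '' {i | w i ≠ 0}ᶜ) := by
  obtain ⟨G, hG, rfl⟩ := hJ
  rw [mem_ideal_span_X_image]
  intro m hm
  by_contra! hmw
  obtain ⟨g, hg, hgm⟩ := mem_ideal_span_monomial_image.mp hf (m + w) (by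
    rw [mem_support_iff, coeff_mul_monomial, mul_one]
    exact mem_support_iff.mp hm)
  refine hwJ (mem_ideal_span_monomial_image.mpr fun w' hw' => ⟨g, hg, ?_⟩)
  rw [Finset.mem_singleton.mp (support_monomial_subset hw')]
  intro i
  by_cases hi : w i = 0
  · have hmi : m i = 0 := hmw i (by simpa using hi)
    simpa [hi, hmi] using hgm i
  · exact ((hG g hg).1 i).trans (Nat.one_le_iff_ne_zero.mpr hi)

/-- A maximal squarefree monomial `x^w ∈ I \ J` bounds the depth of `I/J` by its degree. -/
theorem mdepth_quotMod_le_mdeg {d : ℕ} {I J : Ideal (MvPolynomial (Fin n) K)}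
    (hJ : GenSqfreeGe K d J) {w : Fin n →₀ ℕ} (hw : IsSqfree w)
    (hwI : monomial w (1 : K) ∈ I) (hwJ : monomial w (1 : K) ∉ J)
    (hmax : ∀ i, w i = 0 → monomial (w + Finsupp.single i 1) (1 : K) ∈ J) :
    mdepth K n (quotMod I J) ≤ mdeg w := by
  refine csSup_le' ?_
  rintro k ⟨rs, rfl, hrs, hreg⟩
  have hspan : Ideal.span (Set.range (X : Fin n → MvPolynomial (Fin n) K)) =
      Ideal.span (X '' (∅ : Set (Fin n))ᶜ) := by
    rw [Set.compl_empty, Set.image_univ]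
  rw [hspan] at hrs
  have := isPrime_span_X_image_compl K (∅ : Set (Fin n))
  have hass : IsAssociatedPrime
      (Ideal.span (X '' {i | w i ≠ 0}ᶜ : Set (MvPolynomial (Fin n) K))) (quotMod I J) := by
    refine isAssociatedPrime_iff.mpr ⟨isPrime_span_X_image_compl K _,
      Submodule.Quotient.mk ⟨monomial w 1, hwI⟩, ?_⟩
    have hcolon (f : MvPolynomial (Fin n) K) :
        f ∈ (⊥ : Submodule (MvPolynomial (Fin n) K) (quotMod I J)).colon
          {Submodule.Quotient.mk ⟨monomial w 1, hwI⟩} ↔ f * monomial w 1 ∈ J := by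
      rw [Submodule.mem_colon_singleton, Submodule.mem_bot, ← Submodule.Quotient.mk_smul,
        Submodule.Quotient.mk_eq_zero]
      rfl
    apply le_antisymm
    · rw [Ideal.span_le]
      rintro _ ⟨i, hi, rfl⟩
      refine (hcolon _).mpr ?_
      rw [X, monomial_mul, one_mul, add_comm]
      exact hmax i (by simpa using hi)
    · exact fun f hf => hJ.mem_span_of_mul_monomial_mem hwJ ((hcolon f).mp hf)
  have h := length_le_ringKrullDim_quotient_of_isWeaklyRegular rs hrs hreg.toIsWeaklyRegular hass
    (Ideal.span_mono (Set.image_mono (by simp)))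
  rw [ringKrullDim_quotient_span_X_image_compl, hw.ncard_support] at h
  exact_mod_cast h

/-- If every squarefree monomial of degree `t + 1` in `I` lies in `J`, but not every one of
degree `t` does, then `I/J` has depth at most `t`. -/
theorem mdepth_quotMod_le_of_rho {d t : ℕ} {I J : Ideal (MvPolynomial (Fin n) K)}
    (hJ : GenSqfreeGe K d J) (ht : rho K I J t ≠ 0) (ht' : rho K I J (t + 1) = 0) :
    mdepth K n (quotMod I J) ≤ t := by
  rw [Ne, rho_eq_zero_iff] at ht
  push Not at ht
  obtain ⟨w, hw, rfl, hwI, hwJ⟩ := ht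
  refine mdepth_quotMod_le_mdeg hJ hw hwI hwJ fun i hi =>
    rho_eq_zero_iff.mp ht' _ (hw.add_single hi) (mdeg_add_single w i) ?_
  rw [← one_mul (1 : K), ← monomial_mul]
  exact I.mul_mem_right _ hwI

end SqfreeMonomials

theorem rho_eq_of_no_deg_d2 {K : Type*} [Field K] {n d : ℕ}
    (I J : Ideal (MvPolynomial (Fin n) K)) (hJI : J < I)
    (hI : GenSqfreeGe K d I) (hJ : GenSqfreeGe K (d + 1) J)
    (hdepth : d + 2 ≤ mdepth K n (quotMod I J))
    (h2 : rho K I J (d + 2) = 0) :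
    rho K I (⊥ : Ideal (MvPolynomial (Fin n) K)) d = rho K I J (d + 1) := by
  have h1 : rho K I J (d + 1) = 0 := by
    by_contra h
    have := mdepth_quotMod_le_of_rho hJ h h2
    lia
  have h0 : rho K I J d = 0 := by
    by_contra h
    have := mdepth_quotMod_le_of_rho hJ h h1
    lia
  rw [h1, rho_eq_zero_iff]
  intro m hm hmd hmI
  have := hJ.le_mdeg_of_monomial_mem (rho_eq_zero_iff.mp h0 m hm hmd hmI)
  lia
end

section
/- In S = K[x_1,x_2,x_3,x_4], with I = (x_1, x_3) and J' = (x_1x_4, x_2x_3x_4), one has ρ_2(I\J') = 4 > 3 = ρ_1(I) + ρ_3(I\J') and depth_S(I/J') = 2. -/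
open MvPolynomial

section AssociatedPrimes

open Submodule Pointwise IsLocalRing

theorem IsAssociatedPrime.exists_lt_quotSMulTop {R M : Type*} [CommRing R] [IsNoetherianRing R]
    [IsLocalRing R] [AddCommGroup M] [Module R M] [Module.Finite R M] {p : Ideal R}
    (hp : IsAssociatedPrime p M) {r : R} (hr : r ∈ maximalIdeal R) (hreg : IsSMulRegular M r) :
    ∃ q : Ideal R, IsAssociatedPrime q (QuotSMulTop r M) ∧ p < q := by
  obtain ⟨hprime, x, hx⟩ := isAssociatedPrime_iff.mp hp
  have hpx : ∀ a ∈ p, a • x = 0 := fun a ha => by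
    rw [hx, mem_colon_singleton] at ha
    exact ha
  have hx0 : x ≠ 0 := by
    rintro rfl
    exact hprime.ne_top (by simp [hx])
  let U : Submodule R M := torsionBySet R M p
  have hU : ∀ z, z ∈ U ↔ ∀ a ∈ p, a • z = 0 := fun z => by simp [U, mem_torsionBySet_iff]
  have hnot : ¬ U ≤ r • (⊤ : Submodule R M) := by
    intro hle
    have hbot : U = ⊥ := by
      refine eq_bot_of_le_smul_of_le_jacobson_bot (maximalIdeal R) U
        (IsNoetherian.noetherian U) (fun z hz => ?_) (maximalIdeal_le_jacobson ⊥)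
      obtain ⟨y, -, rfl⟩ := (mem_smul_pointwise_iff_exists _ _ _).mp (hle hz)
      refine smul_mem_smul hr ((hU y).mpr fun a ha => hreg ?_)
      simpa [smul_comm r a y] using (hU _).mp hz a ha
    exact hx0 ((mem_bot R).mp (hbot ▸ (hU x).mpr hpx))
  obtain ⟨z, hzU, hz⟩ := SetLike.not_le_iff_exists.mp hnot
  obtain ⟨q, hq, hle⟩ := exists_le_isAssociatedPrime_of_isNoetherianRing R
    (Submodule.Quotient.mk z : QuotSMulTop r M) (by simpa [Submodule.Quotient.mk_eq_zero] using hz)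
  have hpq : p ≤ q := fun a ha => hle (by
    rw [mem_colon_singleton, mem_bot, ← Submodule.Quotient.mk_smul, (hU z).mp hzU a ha,
      Submodule.Quotient.mk_zero])
  have hrq : r ∈ q := hle (by
    rw [mem_colon_singleton, mem_bot, ← Submodule.Quotient.mk_smul, Submodule.Quotient.mk_eq_zero]
    exact smul_mem_pointwise_smul _ _ _ mem_top)
  refine ⟨q, hq, hpq.lt_of_not_ge fun hqp => hx0 (hreg ?_)⟩
  simpa using hpx r (hqp hrq)

open RingTheory.Sequence in
theorem IsAssociatedPrime.height_add_length_le {R : Type*} [CommRing R] [IsNoetherianRing R]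
    [IsLocalRing R] {rs : List R} (hmem : ∀ r ∈ rs, r ∈ maximalIdeal R) {M : Type*}
    [AddCommGroup M] [Module R M] [Module.Finite R M] (hreg : IsWeaklyRegular M rs)
    {p : Ideal R} (hp : IsAssociatedPrime p M) :
    p.height + rs.length ≤ (maximalIdeal R).height := by
  induction rs generalizing M p with
  | nil => simpa using Ideal.height_mono (le_maximalIdeal hp.isPrime.ne_top)
  | cons r rs ih =>
    rw [isWeaklyRegular_cons_iff] at hreg
    obtain ⟨q, hq, hpq⟩ := hp.exists_lt_quotSMulTop (hmem r (by simp)) hreg.1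
    have := hp.isPrime
    have := hq.isPrime
    calc p.height + (r :: rs).length = p.height + 1 + rs.length := by
          push_cast [List.length_cons]; ring
      _ ≤ q.height + rs.length := by gcongr; exact Ideal.height_add_one_le_of_lt_of_isPrime hpq
      _ ≤ _ := ih (fun s hs => hmem s (by simp [hs])) hreg.2 hq

open RingTheory.Sequence in
theorem IsAssociatedPrime.height_add_length_le_of_le {R M : Type*} [CommRing R]
    [IsNoetherianRing R] [AddCommGroup M] [Module R M] [Module.Finite R M] {m p : Ideal R}
    [m.IsPrime] (hp : IsAssociatedPrime p M) (hpm : p ≤ m) {rs : List R}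
    (hmem : ∀ r ∈ rs, r ∈ m) (hreg : IsWeaklyRegular M rs) :
    p.height + rs.length ≤ m.height := by
  have := hp.isPrime
  let A := Localization.AtPrime m
  have hunder : (p.map (algebraMap R A)).under R = p :=
    IsLocalization.under_map_of_isPrime_disjoint m.primeCompl A this
      (Set.disjoint_left.mpr fun _ ha hap => ha (hpm hap))
  have hass : IsAssociatedPrime (p.map (algebraMap R A)) (LocalizedModule.AtPrime m M) :=
    Module.associatedPrimes.mem_associatedPrimes_of_comap_mem_associatedPrimes_of_isLocalizedModule
      m.primeCompl (LocalizedModule.mkLinearMap m.primeCompl M) _ (by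
        change Ideal.under R _ ∈ _
        rw [hunder]; exact hp)
  have := hass.isPrime
  have key := hass.height_add_length_le (rs := rs.map (algebraMap R A)) (by
      simp only [List.mem_map, forall_exists_index, and_imp, forall_apply_eq_imp_iff₂]
      exact fun r hr => (IsLocalization.AtPrime.to_map_mem_maximal_iff A m r).mpr (hmem r hr))
    (hreg.of_isLocalizedModule A m.primeCompl (LocalizedModule.mkLinearMap m.primeCompl M))
  rw [← IsLocalization.height_under m.primeCompl (p.map _), hunder, List.length_map,
    ← IsLocalization.height_under m.primeCompl (maximalIdeal A),
    Localization.AtPrime.under_maximalIdeal] at key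
  exact key

end AssociatedPrimes

namespace MvPolynomial

theorem isPrime_span_X_image {σ R : Type*} [CommRing R] [IsDomain R] (s : Set σ) :
    (Ideal.span (X '' s : Set (MvPolynomial σ R))).IsPrime := by
  classical
  let φ : MvPolynomial σ R →ₐ[R] MvPolynomial σ R := aeval fun i => if i ∈ s then 0 else X i
  have hφ : RingHom.ker φ = Ideal.span (X '' s) := by
    refine le_antisymm (fun f hf => ?_) (Ideal.span_le.mpr ?_)
    · have hmk : (Ideal.Quotient.mkₐ R (Ideal.span (X '' s))).comp φ =
          Ideal.Quotient.mkₐ R (Ideal.span (X '' s)) := by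
        ext i
        by_cases hi : i ∈ s
        · have : Ideal.Quotient.mk (Ideal.span (X '' s : Set (MvPolynomial σ R))) (X i) = 0 :=
            Ideal.Quotient.eq_zero_iff_mem.mpr (Ideal.subset_span ⟨i, hi, rfl⟩)
          simp [φ, hi, this]
        · simp [φ, hi]
      have := DFunLike.congr_fun hmk f
      rw [AlgHom.comp_apply, (RingHom.mem_ker).mp hf, map_zero] at this
      exact Ideal.Quotient.eq_zero_iff_mem.mp this.symm
    · rintro _ ⟨i, hi, rfl⟩
      simp [φ, hi]
  exact hφ ▸ RingHom.ker_isPrime φ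

theorem span_X_image_lt {σ R : Type*} [CommRing R] [Nontrivial R] {s t : Set σ} (h : s ⊂ t) :
    Ideal.span (X '' s : Set (MvPolynomial σ R)) < Ideal.span (X '' t) := by
  obtain ⟨hst, i, hit, his⟩ := Set.ssubset_iff_exists.mp h
  refine (Ideal.span_mono (Set.image_mono hst)).lt_of_not_ge fun hle => ?_
  have := mem_ideal_span_X_image.mp (hle (Ideal.subset_span ⟨i, hit, rfl⟩))
  obtain ⟨j, hj, hj0⟩ := this (Finsupp.single i 1) (by simp [mem_support_iff])
  rw [Finsupp.single_apply_ne_zero] at hj0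
  exact his (hj0.1 ▸ hj)

theorem card_le_height_span_X_image {σ R : Type*} [CommRing R] [IsDomain R] (s : Finset σ) :
    (s.card : ℕ∞) ≤ (Ideal.span (X '' (s : Set σ) : Set (MvPolynomial σ R))).height := by
  classical
  induction s using Finset.induction_on with
  | empty => simp
  | insert i s hi ih =>
    have := isPrime_span_X_image (R := R) (s : Set σ)
    have := isPrime_span_X_image (R := R) ((insert i s : Finset σ) : Set σ)
    rw [Finset.card_insert_of_notMem hi]
    push_cast [-Finset.coe_insert]
    refine (add_le_add_left ih 1).trans (Ideal.height_add_one_le_of_lt_of_isPrime ?_)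
    exact span_X_image_lt (by exact_mod_cast Finset.ssubset_insert hi)

theorem height_le_natCard {σ K : Type*} [Finite σ] [Field K] {I : Ideal (MvPolynomial σ K)}
    (hI : I ≠ ⊤) : I.height ≤ Nat.card σ := by
  have := Ideal.height_le_ringKrullDim_of_ne_top hI
  rw [ringKrullDim_of_isNoetherianRing, ringKrullDim_eq_zero_of_field, zero_add] at this
  exact_mod_cast this

end MvPolynomial

section QuotMod

open Submodule Pointwise

variable {K : Type*} [Field K] {n : ℕ} (I J : Ideal (MvPolynomial (Fin n) K))

theorem isSMulRegular_quotMod_iff (r : MvPolynomial (Fin n) K) :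
    IsSMulRegular (quotMod I J) r ↔ ∀ f ∈ I, r * f ∈ J → f ∈ J := by
  rw [isSMulRegular_quotient_iff_mem_of_smul_mem]
  simp

theorem mk_mem_smul_top_quotMod_iff (r : MvPolynomial (Fin n) K) (f : I) :
    (Submodule.Quotient.mk f : quotMod I J) ∈ r • (⊤ : Submodule (MvPolynomial (Fin n) K) (quotMod I J)) ↔
      (f : MvPolynomial (Fin n) K) ∈ Ideal.span {r} * I ⊔ J := by
  simp only [mem_smul_pointwise_iff_exists, mem_top, true_and, Submodule.mem_sup,
    Ideal.mem_span_singleton_mul]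
  constructor
  · rintro ⟨y, hy⟩
    obtain ⟨g, rfl⟩ := Submodule.Quotient.mk_surjective _ y
    rw [← Submodule.Quotient.mk_smul, eq_comm, Submodule.Quotient.eq] at hy
    exact ⟨_, ⟨g, g.2, rfl⟩, _, hy, by simp⟩
  · rintro ⟨_, ⟨g, hg, rfl⟩, j, hj, hf⟩
    refine ⟨Submodule.Quotient.mk ⟨g, hg⟩, ?_⟩
    rw [← Submodule.Quotient.mk_smul, eq_comm, Submodule.Quotient.eq]
    simpa [← hf] using hj

theorem isSMulRegular_quotSMulTop_quotMod_iff (r s : MvPolynomial (Fin n) K) :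
    IsSMulRegular (QuotSMulTop r (quotMod I J)) s ↔
      ∀ f ∈ I, s * f ∈ Ideal.span {r} * I ⊔ J → f ∈ Ideal.span {r} * I ⊔ J := by
  rw [isSMulRegular_quotient_iff_mem_of_smul_mem]
  refine (Submodule.Quotient.mk_surjective _).forall.trans ?_
  simp only [← Submodule.Quotient.mk_smul, mk_mem_smul_top_quotMod_iff]
  simp

theorem top_ne_ofList_smul_top_quotMod {a : ℕ} (hI : ¬ I ≤ idealOfVars (Fin n) K ^ (a + 1))
    (hIa : I ≤ idealOfVars (Fin n) K ^ a) (hJ : J ≤ idealOfVars (Fin n) K ^ (a + 1))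
    {rs : List (MvPolynomial (Fin n) K)} (hrs : ∀ r ∈ rs, r ∈ idealOfVars (Fin n) K) :
    (⊤ : Submodule (MvPolynomial (Fin n) K) (quotMod I J)) ≠ Ideal.ofList rs • ⊤ := by
  intro htop
  refine hI fun f hf => ?_
  have hlift : ∀ z ∈ Ideal.ofList rs • (⊤ : Submodule (MvPolynomial (Fin n) K) (quotMod I J)),
      ∃ g : I, Submodule.Quotient.mk g = z ∧ (g : MvPolynomial (Fin n) K) ∈
        idealOfVars (Fin n) K ^ (a + 1) := by
    intro z hz
    induction hz using Submodule.smul_induction_on' with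
    | smul r hr z _ =>
      obtain ⟨g, rfl⟩ := Submodule.Quotient.mk_surjective _ z
      refine ⟨r • g, rfl, ?_⟩
      rw [pow_succ']
      exact Ideal.mul_mem_mul (Ideal.span_le.mpr hrs hr) (hIa g.2)
    | add z _ w _ hz hw =>
      obtain ⟨g, rfl, hg⟩ := hz
      obtain ⟨h, rfl, hh⟩ := hw
      exact ⟨g + h, rfl, add_mem hg hh⟩
  obtain ⟨g, hg, hg2⟩ := hlift (Submodule.Quotient.mk ⟨f, hf⟩) (htop ▸ mem_top)
  have := (Submodule.Quotient.eq _).mp hg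
  simpa using sub_mem hg2 (hJ this)

end QuotMod

/-- The squarefree exponent vector with support `s`. -/
noncomputable def sqfreeExponent {n : ℕ} (s : Finset (Fin n)) : Fin n →₀ ℕ :=
  Finsupp.equivFunOnFinite.symm fun i => if i ∈ s then 1 else 0

@[simp]
theorem sqfreeExponent_apply {n : ℕ} (s : Finset (Fin n)) (i : Fin n) :
    sqfreeExponent s i = if i ∈ s then 1 else 0 := rfl

theorem sqfreeExponent_injective {n : ℕ} :
    Function.Injective (sqfreeExponent : Finset (Fin n) → _) := by
  intro s t h
  ext i
  have := DFunLike.congr_fun h i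
  by_cases hs : i ∈ s <;> by_cases ht : i ∈ t <;> simp [hs, ht] at this ⊢

theorem mdeg_sqfreeExponent {n : ℕ} (s : Finset (Fin n)) : mdeg (sqfreeExponent s) = s.card := by
  simp [mdeg, Finsupp.sum_fintype]

theorem rho_eq_card {K : Type*} [Field K] {n : ℕ} (I J : Ideal (MvPolynomial (Fin n) K)) (t : ℕ)
    (P Q : Finset (Fin n) → Prop) [DecidablePred P] [DecidablePred Q]
    (hP : ∀ s, monomial (sqfreeExponent s) (1 : K) ∈ I ↔ P s)
    (hQ : ∀ s, monomial (sqfreeExponent s) (1 : K) ∈ J ↔ Q s) :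
    rho K I J t = (Finset.univ.filter fun s => s.card = t ∧ P s ∧ ¬ Q s).card := by
  rw [← Set.ncard_coe_finset, ← Set.ncard_image_of_injective _ sqfreeExponent_injective, rho]
  congr 1
  ext m
  simp only [Set.mem_ofPred_eq, Set.mem_image, Finset.coe_filter, Finset.mem_univ, true_and]
  constructor
  · rintro ⟨hm, hdeg, hI, hJ⟩
    have hsupp : sqfreeExponent m.support = m := by
      ext i
      have := hm i
      by_cases hi : m i = 0
      · simp [hi]
      · simp [hi]; omega
    rw [← hsupp] at hdeg hI hJ
    rw [mdeg_sqfreeExponent] at hdeg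
    exact ⟨_, ⟨hdeg, (hP _).mp hI, (hQ _).not.mp hJ⟩, hsupp⟩
  · rintro ⟨s, ⟨hs, hPs, hQs⟩, rfl⟩
    refine ⟨fun i => ?_, (mdeg_sqfreeExponent s).trans hs, (hP s).mpr hPs, (hQ s).not.mpr hQs⟩
    rw [sqfreeExponent_apply]
    split_ifs <;> simp

section Example

variable (K : Type*) [Field K]

local notation "S" => MvPolynomial (Fin 4) K
local notation "I₀" => (Ideal.span {X 0, X 2} : Ideal (MvPolynomial (Fin 4) K))
local notation "J₀" => (Ideal.span {X 0 * X 3, X 1 * X 2 * X 3} : Ideal (MvPolynomial (Fin 4) K))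

theorem mem_span_X_zero_X_two_iff (f : S) :
    f ∈ I₀ ↔ ∀ m ∈ f.support, m 0 ≠ 0 ∨ m 2 ≠ 0 := by
  rw [← Set.image_pair, mem_ideal_span_X_image]
  simp

theorem single_add_le_iff {σ : Type*} {i : σ} {a : ℕ} {g m : σ →₀ ℕ} (hg : g i = 0) :
    Finsupp.single i a + g ≤ m ↔ a ≤ m i ∧ g ≤ m := by
  classical
  simp only [Finsupp.le_def, Finsupp.add_apply, Finsupp.single_apply]
  constructor
  · refine fun h => ⟨by simpa [hg] using h i, fun j => (Nat.le_add_left _ _).trans (h j)⟩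
  · rintro ⟨ha, h⟩ j
    by_cases hj : i = j
    · subst hj; simpa [hg] using ha
    · simpa [hj] using h j

theorem mem_relations_iff (f : S) :
    f ∈ J₀ ↔ ∀ m ∈ f.support, m 3 ≠ 0 ∧ (m 0 ≠ 0 ∨ m 1 ≠ 0 ∧ m 2 ≠ 0) := by
  have : J₀ = Ideal.span ((fun m => monomial m (1 : K)) ''
      {Finsupp.single 0 1 + Finsupp.single 3 1,
        Finsupp.single 1 1 + (Finsupp.single 2 1 + Finsupp.single 3 1)}) := by
    simp [Set.image_pair, X, monomial_mul, add_assoc]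
  rw [this, mem_ideal_span_monomial_image]
  refine forall₂_congr fun m _ => ?_
  simp only [Set.mem_insert_iff, Set.mem_singleton_iff, exists_eq_or_imp, exists_eq_left]
  rw [single_add_le_iff (by simp), single_add_le_iff (by simp), single_add_le_iff (by simp)]
  simp only [Finsupp.single_le_iff]
  omega

theorem mem_span_X_two_mul_sup_iff (f : S) :
    f ∈ Ideal.span {X 2} * I₀ ⊔ J₀ ↔ ∀ m ∈ f.support,
      m 0 ≠ 0 ∧ m 2 ≠ 0 ∨ 2 ≤ m 2 ∨ m 3 ≠ 0 ∧ (m 0 ≠ 0 ∨ m 1 ≠ 0 ∧ m 2 ≠ 0) := by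
  have : Ideal.span {X 2} * I₀ ⊔ J₀ = Ideal.span ((fun m => monomial m (1 : K)) ''
      {Finsupp.single 0 1 + Finsupp.single 3 1,
        Finsupp.single 1 1 + (Finsupp.single 2 1 + Finsupp.single 3 1),
        Finsupp.single 2 1 + Finsupp.single 0 1, Finsupp.single 2 2}) := by
    rw [Ideal.span_mul_span', ← Ideal.span_union]
    congr 1
    simp [Set.image_insert_eq, X, monomial_mul, add_assoc, ← Finsupp.single_add]
  rw [this, mem_ideal_span_monomial_image]
  refine forall₂_congr fun m _ => ?_
  simp only [Set.mem_insert_iff, Set.mem_singleton_iff, exists_eq_or_imp, exists_eq_left]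
  rw [single_add_le_iff (by simp), single_add_le_iff (by simp), single_add_le_iff (by simp),
    single_add_le_iff (by simp)]
  simp only [Finsupp.single_le_iff]
  omega

theorem monomial_sqfreeExponent_mem_span_X_zero_X_two_iff (s : Finset (Fin 4)) :
    monomial (sqfreeExponent s) (1 : K) ∈ I₀ ↔ 0 ∈ s ∨ 2 ∈ s := by
  classical
  simp [mem_span_X_zero_X_two_iff, support_monomial]

theorem monomial_sqfreeExponent_mem_relations_iff (s : Finset (Fin 4)) :
    monomial (sqfreeExponent s) (1 : K) ∈ J₀ ↔ 3 ∈ s ∧ (0 ∈ s ∨ 1 ∈ s ∧ 2 ∈ s) := by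
  classical
  simp [mem_relations_iff, support_monomial]

theorem isSMulRegular_X_two : IsSMulRegular (quotMod I₀ J₀) (X 2 : S) := by
  rw [isSMulRegular_quotMod_iff]
  intro f hf h
  rw [mem_span_X_zero_X_two_iff] at hf
  rw [mem_relations_iff] at h ⊢
  intro m hm
  have h1 := hf m hm
  have h2 := h (Finsupp.single 2 1 + m) (by
    rw [mem_support_iff] at hm ⊢
    rwa [coeff_X_mul])
  simp at h2
  omega

theorem coeff_single_add_X_add_X_mul {σ R : Type*} [CommSemiring R] {i j : σ} {m : σ →₀ ℕ}
    (hij : i ≠ j) (hm : m j = 0) (f : MvPolynomial σ R) :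
    coeff (Finsupp.single i 1 + m) ((X i + X j) * f) = coeff m f := by
  classical
  rw [add_mul, coeff_add, coeff_X_mul, coeff_X_mul', if_neg, add_zero]
  simp [hm, hij]

theorem isSMulRegular_X_one_add_X_three :
    IsSMulRegular (QuotSMulTop (X 2 : S) (quotMod I₀ J₀)) (X 1 + X 3 : S) := by
  rw [isSMulRegular_quotSMulTop_quotMod_iff]
  intro f hf h
  rw [mem_span_X_zero_X_two_iff] at hf
  rw [mem_span_X_two_mul_sup_iff] at h ⊢
  intro m hm
  have h0 := hf m hm
  rw [mem_support_iff] at hm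
  have h1 : m 3 = 0 → _ := fun h3 => h (Finsupp.single 1 1 + m) (by
    rwa [mem_support_iff, coeff_single_add_X_add_X_mul (by decide) h3])
  have h2 : m 1 = 0 → _ := fun h1 => h (Finsupp.single 3 1 + m) (by
    rwa [mem_support_iff, add_comm (X 1), coeff_single_add_X_add_X_mul (by decide) h1])
  simp at h1 h2
  omega

theorem isRegular_X_two_X_one_add_X_three :
    RingTheory.Sequence.IsRegular (quotMod I₀ J₀) [(X 2 : S), X 1 + X 3] where
  toIsWeaklyRegular := by
    rw [RingTheory.Sequence.isWeaklyRegular_cons_iff,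
      RingTheory.Sequence.isWeaklyRegular_singleton_iff]
    exact ⟨isSMulRegular_X_two K, isSMulRegular_X_one_add_X_three K⟩
  top_ne_smul := by
    have hX : ∀ i, (X i : S) ∈ idealOfVars (Fin 4) K := fun i => Ideal.subset_span ⟨i, rfl⟩
    refine top_ne_ofList_smul_top_quotMod (a := 1) _ _ (fun h => ?_) ?_ ?_ ?_
    · have := h (Ideal.subset_span (Set.mem_insert (X 0 : S) _))
      rw [X, monomial_mem_pow_idealOfVars_iff _ _ one_ne_zero] at this
      simp at this
    · rw [pow_one, Ideal.span_le]
      rintro _ (rfl | rfl) <;> exact hX _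
    · rw [sq, Ideal.span_le]
      rintro _ (rfl | rfl)
      · exact Ideal.mul_mem_mul (hX _) (hX _)
      · exact Ideal.mul_mem_mul (Ideal.mul_mem_right _ _ (hX _)) (hX _)
    · simp only [List.mem_cons, List.not_mem_nil, or_false]
      rintro _ (rfl | rfl)
      · exact hX _
      · exact add_mem (hX _) (hX _)

theorem isAssociatedPrime_span_X_zero_X_one :
    IsAssociatedPrime (Ideal.span (X '' (({0, 1} : Finset (Fin 4)) : Set (Fin 4))) : Ideal S)
      (quotMod I₀ J₀) := by
  have hmem : (X 3 * X 2 : S) ∈ I₀ := Ideal.mul_mem_left _ _ (Ideal.subset_span (by simp))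
  refine isAssociatedPrime_iff.mpr ⟨isPrime_span_X_image _,
    Submodule.Quotient.mk ⟨X 3 * X 2, hmem⟩, ?_⟩
  ext f
  rw [Submodule.mem_colon_singleton, Submodule.mem_bot, ← Submodule.Quotient.mk_smul,
    Submodule.Quotient.mk_eq_zero, Submodule.mem_comap]
  change _ ↔ f * (X 3 * X 2) ∈ J₀
  have hcomm : f * (X 3 * X 2) = X 3 * (X 2 * f) := by ring
  rw [hcomm, mem_relations_iff, mem_ideal_span_X_image]
  simp only [support_X_mul, Finset.forall_mem_map]
  simp

theorem mdepth_example : mdepth K 4 (quotMod I₀ J₀) = 2 := by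
  refine IsGreatest.csSup_eq ⟨⟨_, rfl, ?_, isRegular_X_two_X_one_add_X_three K⟩, ?_⟩
  · have hX : ∀ i, (X i : S) ∈ Ideal.span (Set.range X) := fun i => Ideal.subset_span ⟨i, rfl⟩
    simp only [List.mem_cons, List.not_mem_nil, or_false]
    rintro _ (rfl | rfl)
    · exact hX _
    · exact add_mem (hX _) (hX _)
  · rintro _ ⟨rs, rfl, hmem, hreg⟩
    rw [← Set.image_univ] at hmem
    have hprime := isPrime_span_X_image (R := K) (Set.univ : Set (Fin 4))
    have hle := (isAssociatedPrime_span_X_zero_X_one K).height_add_length_le_of_le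
      (Ideal.span_mono (Set.image_mono (Set.subset_univ _))) hmem hreg.toIsWeaklyRegular
    have h2 := card_le_height_span_X_image (R := K) ({0, 1} : Finset (Fin 4))
    have h4 := height_le_natCard hprime.ne_top
    have : ((2 : ℕ) : ℕ∞) + rs.length ≤ (4 : ℕ) :=
      (add_le_add_left h2 _).trans (hle.trans (by simpa using h4))
    norm_cast at this
    omega

end Example

theorem example_tight' {K : Type*} [Field K] :
    rho K (Ideal.span {X 0, X 2}) (Ideal.span {X 0 * X 3, X 1 * X 2 * X 3} :
      Ideal (MvPolynomial (Fin 4) K)) 2 = 4 ∧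
    rho K (Ideal.span {X 0, X 2}) (⊥ : Ideal (MvPolynomial (Fin 4) K)) 1 +
      rho K (Ideal.span {X 0, X 2}) (Ideal.span {X 0 * X 3, X 1 * X 2 * X 3} :
        Ideal (MvPolynomial (Fin 4) K)) 3 = 3 ∧
    mdepth K 4 (quotMod (Ideal.span {X 0, X 2})
      (Ideal.span {X 0 * X 3, X 1 * X 2 * X 3} :
        Ideal (MvPolynomial (Fin 4) K))) = 2 := by
  refine ⟨?_, ?_, mdepth_example K⟩
  · rw [rho_eq_card _ _ _ _ _ (monomial_sqfreeExponent_mem_span_X_zero_X_two_iff K)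
      (monomial_sqfreeExponent_mem_relations_iff K)]
    decide
  · rw [rho_eq_card _ _ _ _ _ (monomial_sqfreeExponent_mem_span_X_zero_X_two_iff K)
      (monomial_sqfreeExponent_mem_relations_iff K),
      rho_eq_card _ _ _ _ (fun _ => False) (monomial_sqfreeExponent_mem_span_X_zero_X_two_iff K)
        (by simp)]
    decide
end
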